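/- Fix a, b > 0. For u > 0 set ρ_u = P(X > u a, Y > u b)/P(X > u a), and let ρ = a(1/a + 1/b − V(a,b)) be its limit as u → ∞. Then lim_{u→∞} u·(ρ_u − ρ) = (1/(2a)) · (ρ − 2a/b) · (ρ − 1). -/

import Mathlib

open Filter MeasureTheory
open scoped Topology

/-- Second-order expansion at infinity of `u ↦ exp (-c / u)`. -/
theorem tendsto_sq_mul_exp_neg_div_sub (c : ℝ) :
    Tendsto (fun u : ℝ => u ^ 2 * (Real.exp (-(c / u)) - 1 + c / u)) atTop (𝓝 (c ^ 2 / 2)) := by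
  rw [tendsto_iff_norm_sub_tendsto_zero]
  have hlim : Tendsto (fun u : ℝ => |c| ^ 3 / u) atTop (𝓝 0) :=
    tendsto_const_nhds.div_atTop tendsto_id
  refine squeeze_zero' (Eventually.of_forall fun _ => norm_nonneg _) ?_ hlim
  filter_upwards [eventually_ge_atTop |c|, eventually_gt_atTop 0] with u hcu hu
  have hx : |-(c / u)| ≤ 1 := by
    rw [abs_neg, abs_div, abs_of_pos hu]
    exact (div_le_one hu).2 hcu
  have hb := Real.exp_bound hx (n := 3) (by norm_num)
  rw [abs_neg, abs_div, abs_of_pos hu] at hb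
  norm_num [Finset.sum_range_succ, Nat.factorial] at hb
  have hrw : u ^ 2 * (Real.exp (-(c / u)) - 1 + c / u) - c ^ 2 / 2
      = u ^ 2 * (Real.exp (-(c / u)) - (1 + -(c / u) + (c / u) ^ 2 / 2)) := by
    field_simp
    ring
  rw [hrw, Real.norm_eq_abs, abs_mul, abs_of_pos (pow_pos hu 2)]
  calc _ ≤ u ^ 2 * ((|c| / u) ^ 3 * (2 / 9)) := by gcongr
    _ = |c| ^ 3 / u * (2 / 9) := by field_simp
    _ ≤ |c| ^ 3 / u := mul_le_of_le_one_right (by positivity) (by norm_num)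

/-- First-order expansion at infinity of `u ↦ exp (-c / u)`. -/
theorem tendsto_mul_one_sub_exp_neg_div (c : ℝ) :
    Tendsto (fun u : ℝ => u * (1 - Real.exp (-(c / u)))) atTop (𝓝 c) := by
  have h := (tendsto_const_nhds (x := c)).sub
    ((tendsto_sq_mul_exp_neg_div_sub c).mul tendsto_inv_atTop_zero)
  rw [mul_zero, sub_zero] at h
  refine h.congr' ?_
  filter_upwards [eventually_gt_atTop 0] with u hu
  field_simp
  ring

/-- Complementary probability of a strict upper tail. -/
theorem toReal_measure_gt {Ω : Type*} [MeasurableSpace Ω] {P : Measure Ω} [IsProbabilityMeasure P]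
    {X : Ω → ℝ} (hX : Measurable X) (x : ℝ) :
    (P {ω | x < X ω}).toReal = 1 - (P {ω | X ω ≤ x}).toReal := by
  have h := probReal_compl_eq_one_sub (μ := P) (measurableSet_le hX (measurable_const (a := x)))
  rw [Set.compl_ofPred] at h
  simpa only [not_le, Measure.real] using h

/-- Inclusion-exclusion for a joint strict upper tail. -/
theorem toReal_measure_gt_and_gt {Ω : Type*} [MeasurableSpace Ω] {P : Measure Ω}
    [IsProbabilityMeasure P] {X Y : Ω → ℝ} (hX : Measurable X) (hY : Measurable Y) (x y : ℝ) :
    (P {ω | x < X ω ∧ y < Y ω}).toReal =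
      1 - (P {ω | X ω ≤ x}).toReal - (P {ω | Y ω ≤ y}).toReal
        + (P {ω | X ω ≤ x ∧ Y ω ≤ y}).toReal := by
  have hA : MeasurableSet {ω | X ω ≤ x} := measurableSet_le hX measurable_const
  have hB : MeasurableSet {ω | Y ω ≤ y} := measurableSet_le hY measurable_const
  have hc := probReal_compl_eq_one_sub (μ := P) (hA.union hB)
  have hu := measureReal_union_add_inter (μ := P) (s := {ω | X ω ≤ x}) hB
  have hs : ({ω | X ω ≤ x} ∪ {ω | Y ω ≤ y})ᶜ = {ω | x < X ω ∧ y < Y ω} := by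
    ext ω
    simp
  rw [hs] at hc
  rw [← Set.ofPred_and] at hu
  simp only [Measure.real] at hc hu
  linarith

/-- with `ρ_u = P(X > ua, Y > ub)/P(X > ua)` and limit
`ρ = a(1/a + 1/b − V(a,b))`, one has
`lim_{u→∞} u (ρ_u − ρ) = (1/(2a)) (ρ − 2a/b)(ρ − 1)`. -/
theorem stmt9
    (Ω : Type) [MeasurableSpace Ω] (P : Measure Ω) [IsProbabilityMeasure P]
    (X Y : Ω → ℝ) (hX : Measurable X) (hY : Measurable Y)
    (V : ℝ → ℝ → ℝ)
    (hVpos : ∀ x₁ x₂ : ℝ, 0 < x₁ → 0 < x₂ → 0 < V x₁ x₂)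
    (hVcont : ContinuousOn (fun q : ℝ × ℝ => V q.1 q.2) (Set.Ioi 0 ×ˢ Set.Ioi 0))
    (hVhom : ∀ c x₁ x₂ : ℝ, 0 < c → 0 < x₁ → 0 < x₂ →
      V (c * x₁) (c * x₂) = V x₁ x₂ / c)
    (hFX : ∀ x : ℝ, 0 < x → (P {ω | X ω ≤ x}).toReal = Real.exp (-1 / x))
    (hFY : ∀ x : ℝ, 0 < x → (P {ω | Y ω ≤ x}).toReal = Real.exp (-1 / x))
    (hJ : ∀ x₁ x₂ : ℝ, 0 < x₁ → 0 < x₂ →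
      (P {ω | X ω ≤ x₁ ∧ Y ω ≤ x₂}).toReal = Real.exp (-(V x₁ x₂)))
    (a b : ℝ) (ha : 0 < a) (hb : 0 < b)
    (ρu : ℝ → ℝ)
    (hρu : ∀ u : ℝ, 0 < u → ρu u =
      (P {ω | u * a < X ω ∧ u * b < Y ω}).toReal / (P {ω | u * a < X ω}).toReal)
    (ρ : ℝ) (hρ : ρ = a * (1 / a + 1 / b - V a b)) :
    Tendsto (fun u : ℝ => u * (ρu u - ρ)) atTop
      (𝓝 ((1 / (2 * a)) * (ρ - 2 * a / b) * (ρ - 1))) := by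
  have hp : 1 / a ≠ 0 := by positivity
  have hlim := ((((tendsto_sq_mul_exp_neg_div_sub (V a b)).sub
    (tendsto_sq_mul_exp_neg_div_sub (1 / b))).add
    ((tendsto_sq_mul_exp_neg_div_sub (1 / a)).const_mul (ρ - 1)))).div
    (tendsto_mul_one_sub_exp_neg_div (1 / a)) hp
  have hval : ((V a b) ^ 2 / 2 - (1 / b) ^ 2 / 2 + (ρ - 1) * ((1 / a) ^ 2 / 2)) / (1 / a)
      = (1 / (2 * a)) * (ρ - 2 * a / b) * (ρ - 1) := by
    rw [hρ]
    field_simp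
    ring
  rw [hval] at hlim
  refine hlim.congr' ?_
  filter_upwards [eventually_gt_atTop 0] with u hu
  have hua : 0 < u * a := mul_pos hu ha
  have hub : 0 < u * b := mul_pos hu hb
  have ea : -1 / (u * a) = -(1 / a / u) := by field_simp
  have eb : -1 / (u * b) = -(1 / b / u) := by field_simp
  have hlt : Real.exp (-(1 / a / u)) < 1 := Real.exp_lt_one_iff.2 (neg_neg_of_pos (by positivity))
  have hD : 1 - Real.exp (-(1 / a / u)) ≠ 0 := (sub_pos.2 hlt).ne'
  have hV : V a b = 1 / a + 1 / b - ρ * (1 / a) := by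
    rw [hρ]
    field_simp
    ring
  rw [hρu u hu, toReal_measure_gt_and_gt hX hY, toReal_measure_gt hX, hFX _ hua, hFY _ hub,
    hJ _ _ hua hub, hVhom u a b hu ha hb, ea, eb]
  simp only [Pi.div_apply]
  have hlin : V a b / u = 1 / a / u + 1 / b / u - ρ * (1 / a / u) := by
    rw [hV]
    ring
  generalize Real.exp (-(V a b / u)) = ev
  generalize Real.exp (-(1 / b / u)) = eq
  generalize Real.exp (-(1 / a / u)) = ep at hD ⊢
  rw [hlin]
  generalize 1 / a / u = p
  generalize 1 / b / u = q
  field_simp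
  ring
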